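/- arXiv:1907.06032 — 2 statements merged into one kernel-verified Lean document; each statement's English description precedes it below -/
import Mathlib

section
/- Let S_1 and S_2 be subspaces of ℝ^m with orthonormal basis matrices U_1 ∈ ℝ^{m×p} and U_2 ∈ ℝ^{m×q} (the columns of U_i form an orthonormal basis of S_i). Then dim(S_1 ∩ S_2) ≤ ‖U_1ᵀU_2‖_F², where ‖·‖_F denotes the Frobenius norm. -/
open Matrix

noncomputable section

/-- The sum of the squared entries of a real matrix is the trace of its Gram matrix. -/
theorem sum_sq_eq_trace_transpose_mul_self {m n : Type*} [Fintype m] [Fintype n]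
    (A : Matrix m n ℝ) : ∑ i, ∑ j, A i j ^ 2 = (Aᵀ * A).trace := by
  rw [Finset.sum_comm]
  simp [Matrix.trace, Matrix.mul_apply, sq]

/-- Every subspace of `ℝ^m` has an orthonormal basis matrix; here only the inclusion of the
columns in the subspace is recorded. -/
theorem exists_orthonormal_columns_mem {m : ℕ} (S : Submodule ℝ (Fin m → ℝ)) :
    ∃ W : Matrix (Fin m) (Fin (Module.finrank ℝ S)) ℝ,
      Wᵀ * W = 1 ∧ ∀ j, W.col j ∈ S := by
  let e := (WithLp.linearEquiv 2 ℝ (Fin m → ℝ)).symm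
  let T : Submodule ℝ (EuclideanSpace ℝ (Fin m)) := S.map e.toLinearMap
  have hT : Module.finrank ℝ T = Module.finrank ℝ S := e.finrank_map_eq S
  let b := (stdOrthonormalBasis ℝ T).reindex (finCongr hT)
  refine ⟨Matrix.of fun i j => (b j : EuclideanSpace ℝ (Fin m)) i, ?_, fun j => ?_⟩
  · ext j k
    have h := orthonormal_iff_ite.mp b.orthonormal j k
    rw [Submodule.coe_inner, PiLp.inner_apply] at h
    rw [Matrix.mul_apply, Matrix.one_apply, ← h]
    simp [mul_comm]
  · obtain ⟨x, hx, hxj⟩ := (b j).2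
    have : (Matrix.of fun i j => (b j : EuclideanSpace ℝ (Fin m)) i).col j = x := by
      ext i
      simp only [Matrix.col_apply, Matrix.of_apply, ← hxj]
      rfl
    rwa [this]

/-- If `U` has orthonormal columns, `U Uᵀ` fixes every matrix whose columns lie in the range
of `U`. -/
theorem mul_transpose_mul_eq_of_col_mem_range {m p d : Type*} [Fintype m] [Fintype p]
    [DecidableEq p] {U : Matrix m p ℝ} (hU : Uᵀ * U = 1) {W : Matrix m d ℝ}
    (hW : ∀ j, W.col j ∈ LinearMap.range U.mulVecLin) : U * (Uᵀ * W) = W := by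
  choose c hc using hW
  have hWc : W = U * Matrix.of fun i j => c j i := by
    ext i j
    exact (congrFun (hc j) i).symm
  rw [hWc, ← Matrix.mul_assoc Uᵀ, hU, Matrix.one_mul]

/-- If `U_1` and `U_2` are orthonormal basis matrices of the subspaces
`S_1` and `S_2` of `ℝ^m`, then `dim(S_1 ∩ S_2) ≤ ‖U_1ᵀ U_2‖_F²`. -/
theorem dim_inf_le_frobenius_sq {m p q : ℕ}
    (S1 S2 : Submodule ℝ (Fin m → ℝ))
    (U1 : Matrix (Fin m) (Fin p) ℝ) (U2 : Matrix (Fin m) (Fin q) ℝ)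
    (hU1 : U1ᵀ * U1 = 1) (hU2 : U2ᵀ * U2 = 1)
    (hS1 : LinearMap.range U1.mulVecLin = S1) (hS2 : LinearMap.range U2.mulVecLin = S2) :
    (Module.finrank ℝ ↥(S1 ⊓ S2) : ℝ) ≤ ∑ i, ∑ j, ((U1ᵀ * U2) i j) ^ 2 := by
  obtain ⟨W, hW, hWS⟩ := exists_orthonormal_columns_mem (S1 ⊓ S2)
  have h1 : U1 * (U1ᵀ * W) = W :=
    mul_transpose_mul_eq_of_col_mem_range hU1 fun j => hS1 ▸ (hWS j).1
  have h2 : U2 * (U2ᵀ * W) = W :=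
    mul_transpose_mul_eq_of_col_mem_range hU2 fun j => hS2 ▸ (hWS j).2
  set A := U1ᵀ * U2 with hA
  set X := U1ᵀ * W with hX
  set Y := U2ᵀ * W with hY
  have hXX : Xᵀ * X = 1 := by
    rw [hX, Matrix.transpose_mul, Matrix.transpose_transpose, Matrix.mul_assoc, ← hX, h1, hW]
  have hYY : Yᵀ * Y = 1 := by
    rw [hY, Matrix.transpose_mul, Matrix.transpose_transpose, Matrix.mul_assoc, ← hY, h2, hW]
  have hAY : A * Y = X := by rw [hA, Matrix.mul_assoc, h2]
  have hcross : (Aᵀ * (X * Yᵀ)).trace = Module.finrank ℝ ↥(S1 ⊓ S2) := by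
    rw [← Matrix.mul_assoc, Matrix.trace_mul_comm, ← Matrix.mul_assoc, ← Matrix.transpose_mul,
      hAY, hXX, Matrix.trace_one, Fintype.card_fin]
  have hcross' : ((X * Yᵀ)ᵀ * A).trace = Module.finrank ℝ ↥(S1 ⊓ S2) := by
    rw [← hcross, ← Matrix.trace_transpose, Matrix.transpose_mul, Matrix.transpose_transpose]
  have hsq : ((X * Yᵀ)ᵀ * (X * Yᵀ)).trace = Module.finrank ℝ ↥(S1 ⊓ S2) := by
    rw [Matrix.transpose_mul, Matrix.transpose_transpose, Matrix.mul_assoc,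
      ← Matrix.mul_assoc Xᵀ, hXX, Matrix.one_mul, Matrix.trace_mul_comm, hYY,
      Matrix.trace_one, Fintype.card_fin]
  have hnonneg : 0 ≤ ((A - X * Yᵀ)ᵀ * (A - X * Yᵀ)).trace := by
    rw [← sum_sq_eq_trace_transpose_mul_self]
    positivity
  rw [Matrix.transpose_sub, Matrix.sub_mul, Matrix.mul_sub, Matrix.mul_sub, Matrix.trace_sub,
    Matrix.trace_sub, Matrix.trace_sub, hcross, hcross', hsq] at hnonneg
  rw [sum_sq_eq_trace_transpose_mul_self]
  linarith
end
end

section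
/- Let P, Y, Z be elements of a real inner product space. Define β = ⟨P, Y⟩/⟨Y, Z⟩ − 2⟨P, Z⟩‖Y‖²/⟨Y, Z⟩² if ⟨Y, Z⟩ ≠ 0, and β = 0 otherwise, and set H = −P + βZ. Then ⟨P, H⟩ ≤ −(7/8)‖P‖². -/
open scoped RealInnerProductSpace

/-- descent-direction inequality for the Hager–Zhang-type conjugate
gradient update: with `β` as in the update rule and `H = −P + β Z`, one has
`⟪P, H⟫ ≤ −(7/8)‖P‖²`. -/
theorem hager_zhang_descent {F : Type*} [NormedAddCommGroup F] [InnerProductSpace ℝ F]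
    (P Y Z : F) (β : ℝ)
    (hβ : β = if ⟪Y, Z⟫ ≠ 0 then
        ⟪P, Y⟫ / ⟪Y, Z⟫ - 2 * ⟪P, Z⟫ / ⟪Y, Z⟫ ^ 2 * ‖Y‖ ^ 2
      else 0)
    (H : F) (hH : H = -P + β • Z) :
    ⟪P, H⟫ ≤ -(7 / 8) * ‖P‖ ^ 2 := by
  have key (t : ℝ) : t * ⟪P, Y⟫ - 2 * t ^ 2 * ‖Y‖ ^ 2 ≤ ‖P‖ ^ 2 / 8 := by
    have h : ‖P - (4 * t) • Y‖ ^ 2 = ‖P‖ ^ 2 - 8 * t * ⟪P, Y⟫ + 16 * t ^ 2 * ‖Y‖ ^ 2 := by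
      rw [norm_sub_sq_real, real_inner_smul_right, norm_smul, mul_pow, Real.norm_eq_abs, sq_abs]
      ring
    linarith [sq_nonneg ‖P - (4 * t) • Y‖]
  have hPH : ⟪P, H⟫ = -‖P‖ ^ 2 + β * ⟪P, Z⟫ := by
    rw [hH, inner_add_right, inner_neg_right, real_inner_smul_right, real_inner_self_eq_norm_sq]
  rw [hPH]
  split_ifs at hβ with hc
  · have hβZ : β * ⟪P, Z⟫ = ⟪P, Z⟫ / ⟪Y, Z⟫ * ⟪P, Y⟫
        - 2 * (⟪P, Z⟫ / ⟪Y, Z⟫) ^ 2 * ‖Y‖ ^ 2 := by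
      rw [hβ]
      ring
    linarith [key (⟪P, Z⟫ / ⟪Y, Z⟫)]
  · rw [hβ]
    linarith [sq_nonneg ‖P‖]
end
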